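/- Let θ ∈ C¹(ℝ) and suppose θ̇ has compact support. Then there exists a constant c_S > 0, depending on θ̇ and ω, such that for every nonzero ψ ∈ C_c^∞(Ω₀): Q_θ[ψ] − E₁ ∫_{Ω₀} |ψ|² dx ≥ c_S ( ∫_{Ω₀} |ψ|² dx )³ / ‖ψ‖₁⁴, where ‖ψ‖₁ := ( ∫_ω ( ∫_ℝ |ψ(x₁,x₂,x₃)| dx₁ )² dx₂dx₃ )^{1/2}. -/

import Mathlib

open MeasureTheory Real Set Filter

noncomputable section

/-- First partial derivative ∂₁ of a function on ℝ³ = ℝ × ℝ × ℝ. -/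
def pd1 {E : Type*} [NormedAddCommGroup E] [NormedSpace ℝ E]
    (ψ : ℝ × ℝ × ℝ → E) (x : ℝ × ℝ × ℝ) : E :=
  deriv (fun t => ψ (t, x.2.1, x.2.2)) x.1

/-- Second partial derivative ∂₂. -/
def pd2 {E : Type*} [NormedAddCommGroup E] [NormedSpace ℝ E]
    (ψ : ℝ × ℝ × ℝ → E) (x : ℝ × ℝ × ℝ) : E :=
  deriv (fun t => ψ (x.1, t, x.2.2)) x.2.1

/-- Third partial derivative ∂₃. -/
def pd3 {E : Type*} [NormedAddCommGroup E] [NormedSpace ℝ E]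
    (ψ : ℝ × ℝ × ℝ → E) (x : ℝ × ℝ × ℝ) : E :=
  deriv (fun t => ψ (x.1, x.2.1, t)) x.2.2

/-- Transverse angular derivative ∂_τ = x₃∂₂ − x₂∂₃. -/
def pdtau {E : Type*} [NormedAddCommGroup E] [NormedSpace ℝ E]
    (ψ : ℝ × ℝ × ℝ → E) (x : ℝ × ℝ × ℝ) : E :=
  x.2.2 • pd2 ψ x - x.2.1 • pd3 ψ x

/-- The straight tube Ω₀ = ℝ × ω. -/
def Omega0 (ω : Set (ℝ × ℝ)) : Set (ℝ × ℝ × ℝ) := {x | x.2 ∈ ω}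

/-- Smooth compactly supported test functions with support in Ω (i.e. C_c^∞(Ω)). -/
def IsTest3 {E : Type*} [NormedAddCommGroup E] [NormedSpace ℝ E]
    (Ω : Set (ℝ × ℝ × ℝ)) (ψ : ℝ × ℝ × ℝ → E) : Prop :=
  ContDiff ℝ (⊤ : ℕ∞) ψ ∧ HasCompactSupport ψ ∧ tsupport ψ ⊆ Ω

/-- Partial derivatives on ℝ². -/
def pd1' (f : ℝ × ℝ → ℂ) (p : ℝ × ℝ) : ℂ := deriv (fun t => f (t, p.2)) p.1

def pd2' (f : ℝ × ℝ → ℂ) (p : ℝ × ℝ) : ℂ := deriv (fun t => f (p.1, t)) p.2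

/-- Smooth compactly supported test functions on the cross-section, C_c^∞(ω). -/
def IsTest2 (ω : Set (ℝ × ℝ)) (f : ℝ × ℝ → ℂ) : Prop :=
  ContDiff ℝ (⊤ : ℕ∞) f ∧ HasCompactSupport f ∧ tsupport f ⊆ ω

/-- The lowest Dirichlet eigenvalue E₁ of −Δ on ω, defined variationally. -/
def E1 (ω : Set (ℝ × ℝ)) : ℝ :=
  sInf { r : ℝ | ∃ f : ℝ × ℝ → ℂ, IsTest2 ω f ∧ f ≠ 0 ∧
    r = (∫ p in ω, (‖pd1' f p‖ ^ 2 + ‖pd2' f p‖ ^ 2)) / ∫ p in ω, ‖f p‖ ^ 2 }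

/-- The twisted quadratic form Q_θ[ψ] = ∫_{Ω₀} (|∂₁ψ − θ̇ ∂_τψ|² + |∇'ψ|²). -/
def Qform (θ : ℝ → ℝ) (ω : Set (ℝ × ℝ)) (ψ : ℝ × ℝ × ℝ → ℂ) : ℝ :=
  ∫ x in Omega0 ω,
    (‖pd1 ψ x - deriv θ x.1 • pdtau ψ x‖ ^ 2 + ‖pd2 ψ x‖ ^ 2 + ‖pd3 ψ x‖ ^ 2)

/-- Rotation of the plane by angle ϑ about the origin. -/
def rot (ϑ : ℝ) (p : ℝ × ℝ) : ℝ × ℝ :=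
  (p.1 * Real.cos ϑ + p.2 * Real.sin ϑ, -p.1 * Real.sin ϑ + p.2 * Real.cos ϑ)

/-- The tube is twisted: θ is not constant and ω is not rotationally symmetric about
the origin (in the strong sense: some rotated copy of ω differs from ω on a set of
positive Lebesgue measure). -/
def Twisted (θ : ℝ → ℝ) (ω : Set (ℝ × ℝ)) : Prop :=
  (∃ s t : ℝ, θ s ≠ θ t) ∧
  (∃ ϑ ∈ Set.Ioo (0 : ℝ) (2 * Real.pi), volume (symmDiff (rot ϑ '' ω) ω) ≠ 0)

/-- The tube is untwisted: θ is constant or ω is invariant under every rotation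
about the origin. -/
def Untwisted (θ : ℝ → ℝ) (ω : Set (ℝ × ℝ)) : Prop :=
  (∀ s t : ℝ, θ s = θ t) ∨ (∀ ϑ : ℝ, rot ϑ '' ω = ω)

/-- The square of the mixed norm ‖ψ‖₁² = ∫_ω ( ∫_ℝ |ψ(x₁,x')| dx₁ )² dx'. -/
def mixedNorm1Sq (ω : Set (ℝ × ℝ)) (ψ : ℝ × ℝ × ℝ → ℂ) : ℝ :=
  ∫ p in ω, (∫ t : ℝ, ‖ψ (t, p)‖) ^ 2

theorem integrable_norm_mul_norm_deriv {f : ℝ → ℂ} (hf : ContDiff ℝ 1 f)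
    (hc : HasCompactSupport f) : Integrable (fun t => ‖f t‖ * ‖deriv f t‖) :=
  (hf.continuous.norm.mul hf.continuous_deriv_one.norm).integrable_of_hasCompactSupport
    (hc.norm.mul_right)

theorem hasCompactSupport_norm_sq {X : Type*} [TopologicalSpace X] {f : X → ℂ}
    (hc : HasCompactSupport f) : HasCompactSupport (fun x => ‖f x‖ ^ 2) := by
  simp only [sq]
  exact hc.norm.mul_right

theorem integrable_norm_sq {X : Type*} [TopologicalSpace X] [MeasurableSpace X]
    [OpensMeasurableSpace X] {μ : Measure X} [IsFiniteMeasureOnCompacts μ] {f : X → ℂ}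
    (hf : Continuous f) (hc : HasCompactSupport f) : Integrable (fun x => ‖f x‖ ^ 2) μ :=
  (hf.norm.pow 2).integrable_of_hasCompactSupport
    (hasCompactSupport_norm_sq hc)

theorem norm_sq_le_integral_Ioi {f : ℝ → ℂ} (hf : ContDiff ℝ 1 f) (hc : HasCompactSupport f)
    (s : ℝ) : ‖f s‖ ^ 2 ≤ 2 * ∫ t in Ioi s, ‖f t‖ * ‖deriv f t‖ := by
  have hd : ∀ t, HasDerivAt (fun t => ‖f t‖ ^ 2) (2 * inner ℝ (f t) (deriv f t)) t := fun t =>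
    ((hf.differentiable one_ne_zero) t).hasDerivAt.norm_sq
  have hc' : HasCompactSupport (fun t => ‖f t‖ ^ 2) := hasCompactSupport_norm_sq hc
  have h := hc'.integral_Ioi_deriv_eq (hf.norm_sq ℝ) s
  rw [← integral_const_mul, ← neg_neg (‖f s‖ ^ 2), ← h]
  calc -∫ t in Ioi s, deriv (fun t => ‖f t‖ ^ 2) t
      ≤ ‖∫ t in Ioi s, deriv (fun t => ‖f t‖ ^ 2) t‖ := neg_le_abs _
    _ ≤ _ := norm_integral_le_of_norm_le ((integrable_norm_mul_norm_deriv hf hc).const_mul 2).integrableOn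
      (ae_of_all _ fun t => by
        rw [(hd t).deriv, norm_mul, Real.norm_two]
        gcongr
        exact norm_inner_le_norm _ _)

theorem norm_sq_le_integral_Iic {f : ℝ → ℂ} (hf : ContDiff ℝ 1 f) (hc : HasCompactSupport f)
    (s : ℝ) : ‖f s‖ ^ 2 ≤ 2 * ∫ t in Iic s, ‖f t‖ * ‖deriv f t‖ := by
  have hd : ∀ t, HasDerivAt (fun t => ‖f t‖ ^ 2) (2 * inner ℝ (f t) (deriv f t)) t := fun t =>
    ((hf.differentiable one_ne_zero) t).hasDerivAt.norm_sq
  have hc' : HasCompactSupport (fun t => ‖f t‖ ^ 2) := hasCompactSupport_norm_sq hc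
  have h := hc'.integral_Iic_deriv_eq (hf.norm_sq ℝ) s
  rw [← integral_const_mul, ← h]
  calc ∫ t in Iic s, deriv (fun t => ‖f t‖ ^ 2) t
      ≤ ‖∫ t in Iic s, deriv (fun t => ‖f t‖ ^ 2) t‖ := le_abs_self _
    _ ≤ _ := norm_integral_le_of_norm_le ((integrable_norm_mul_norm_deriv hf hc).const_mul 2).integrableOn
      (ae_of_all _ fun t => by
        rw [(hd t).deriv, norm_mul, Real.norm_two]
        gcongr
        exact norm_inner_le_norm _ _)

theorem sq_integral_mul_le {α : Type*} [MeasurableSpace α] {μ : Measure α} {u v : α → ℝ}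
    (hu : 0 ≤ u) (hv : 0 ≤ v) (hu2 : MemLp u 2 μ) (hv2 : MemLp v 2 μ) :
    (∫ x, u x * v x ∂μ) ^ 2 ≤ (∫ x, u x ^ 2 ∂μ) * ∫ x, v x ^ 2 ∂μ := by
  have h := integral_mul_le_Lp_mul_Lq_of_nonneg (μ := μ) Real.HolderConjugate.two_two
    (ae_of_all _ hu) (ae_of_all _ hv) (by simpa using hu2) (by simpa using hv2)
  simp only [Real.rpow_two, ← Real.sqrt_eq_rpow] at h
  have h0 : 0 ≤ ∫ x, u x * v x ∂μ := integral_nonneg fun x => mul_nonneg (hu x) (hv x)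
  calc _ ≤ (√(∫ x, u x ^ 2 ∂μ) * √(∫ x, v x ^ 2 ∂μ)) ^ 2 := by gcongr
    _ = _ := by
      rw [mul_pow, Real.sq_sqrt (integral_nonneg fun x => sq_nonneg _),
        Real.sq_sqrt (integral_nonneg fun x => sq_nonneg _)]

theorem norm_sq_le_integral_compl_Ioc {f : ℝ → ℂ} (hf : ContDiff ℝ 1 f)
    (hc : HasCompactSupport f) {a b : ℝ} {s : ℝ} (hs : s ∈ (Ioc a b)ᶜ) :
    ‖f s‖ ^ 2 ≤ 2 * ∫ t in (Ioc a b)ᶜ, ‖f t‖ * ‖deriv f t‖ := by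
  have hmono : ∀ s : Set ℝ, s ⊆ (Ioc a b)ᶜ →
      ∫ t in s, ‖f t‖ * ‖deriv f t‖ ≤ ∫ t in (Ioc a b)ᶜ, ‖f t‖ * ‖deriv f t‖ := fun s hs =>
    setIntegral_mono_set (integrable_norm_mul_norm_deriv hf hc).integrableOn
      (ae_of_all _ fun t => by positivity) (LE.le.eventuallyLE hs)
  rcases le_or_gt s a with h | h
  · refine (norm_sq_le_integral_Iic hf hc s).trans ?_
    refine mul_le_mul_of_nonneg_left ?_ zero_le_two
    exact hmono _ fun t ht h' => (h'.1.trans_le (le_trans ht h)).false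
  · have h' : b < s := by
      by_contra! h'
      exact hs ⟨h, h'⟩
    refine (norm_sq_le_integral_Ioi hf hc s).trans ?_
    refine mul_le_mul_of_nonneg_left ?_ zero_le_two
    exact hmono _ fun t ht h'' => ((h'.trans ht).trans_le h''.2).false

theorem integral_norm_sq_le_of_norm_sq_le {f : ℝ → ℂ} (hf : Continuous f)
    (hc : HasCompactSupport f) {S : Set ℝ} (hS : MeasurableSet S) {C : ℝ}
    (h : ∀ s ∈ S, ‖f s‖ ^ 2 ≤ C) : ∫ t in S, ‖f t‖ ^ 2 ≤ √C * ∫ t, ‖f t‖ := by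
  rw [← integral_const_mul]
  have hi : Integrable (fun t => √C * ‖f t‖) :=
    (hf.norm.integrable_of_hasCompactSupport hc.norm).const_mul _
  refine le_trans ?_ (setIntegral_le_integral (s := S) hi (ae_of_all _ fun t => by positivity))
  refine setIntegral_mono_on (integrable_norm_sq hf hc).integrableOn hi.integrableOn hS
    fun t ht => ?_
  rw [sq]
  gcongr
  exact Real.le_sqrt_of_sq_le (h t ht)

/-- Nash's inequality on the line with the interval `(a, b]` removed. -/
theorem nash_compl_Ioc {f : ℝ → ℂ} (hf : ContDiff ℝ 1 f) (hc : HasCompactSupport f)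
    {a b : ℝ} :
    (∫ t in (Ioc a b)ᶜ, ‖f t‖ ^ 2) ^ 3 ≤
      4 * (∫ t in (Ioc a b)ᶜ, ‖deriv f t‖ ^ 2) * ((∫ t, ‖f t‖) ^ 2) ^ 2 := by
  have hCS : (∫ t in (Ioc a b)ᶜ, ‖f t‖ * ‖deriv f t‖) ^ 2 ≤
      (∫ t in (Ioc a b)ᶜ, ‖f t‖ ^ 2) * ∫ t in (Ioc a b)ᶜ, ‖deriv f t‖ ^ 2 :=
    sq_integral_mul_le (fun t => norm_nonneg _) (fun t => norm_nonneg _)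
      ((hf.continuous.norm.memLp_of_hasCompactSupport hc.norm).restrict _)
      ((hf.continuous_deriv_one.norm.memLp_of_hasCompactSupport hc.deriv.norm).restrict _)
  have hC0 : 0 ≤ ∫ t in (Ioc a b)ᶜ, ‖f t‖ * ‖deriv f t‖ := integral_nonneg fun t => by positivity
  have hA0 : 0 ≤ ∫ t in (Ioc a b)ᶜ, ‖f t‖ ^ 2 := integral_nonneg fun t => by positivity
  have hB0 : 0 ≤ ∫ t in (Ioc a b)ᶜ, ‖deriv f t‖ ^ 2 := integral_nonneg fun t => by positivity
  have hAF := integral_norm_sq_le_of_norm_sq_le hf.continuous hc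
    (measurableSet_Ioc (a := a) (b := b)).compl
    fun s hs => norm_sq_le_integral_compl_Ioc hf hc hs
  generalize (∫ t in (Ioc a b)ᶜ, ‖f t‖ ^ 2) = A at *
  generalize (∫ t in (Ioc a b)ᶜ, ‖deriv f t‖ ^ 2) = B at *
  generalize (∫ t in (Ioc a b)ᶜ, ‖f t‖ * ‖deriv f t‖) = C at *
  generalize (∫ t, ‖f t‖) = F at *
  have hA2 : A ^ 2 ≤ 2 * C * F ^ 2 := by
    calc A ^ 2 ≤ (√(2 * C) * F) ^ 2 := by gcongr
      _ = _ := by rw [mul_pow, Real.sq_sqrt (by positivity)]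
  rcases hA0.eq_or_lt with h0 | h0
  · rw [← h0, zero_pow three_ne_zero]
    positivity
  · refine le_of_mul_le_mul_left ?_ h0
    calc A * A ^ 3 = (A ^ 2) ^ 2 := by ring
      _ ≤ (2 * C * F ^ 2) ^ 2 := by gcongr
      _ = 4 * C ^ 2 * F ^ 4 := by ring
      _ ≤ 4 * (A * B) * F ^ 4 := by gcongr
      _ = _ := by ring

theorem integral_cube_le_of_cube_le {α : Type*} [MeasurableSpace α] {μ : Measure α}
    {A B H : α → ℝ} (hA0 : 0 ≤ A) (hB0 : 0 ≤ B) (hH0 : 0 ≤ H) (hA : Integrable A μ)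
    (hB : Integrable B μ) (hH : Integrable H μ) (h : ∀ x, A x ^ 3 ≤ B x * H x ^ 2) :
    (∫ x, A x ∂μ) ^ 3 ≤ (∫ x, B x ∂μ) * (∫ x, H x ∂μ) ^ 2 := by
  have key := ENNReal.lintegral_mul_norm_pow_le (μ := μ) (f := fun x => ENNReal.ofReal (B x))
    (g := fun x => ENNReal.ofReal (H x)) hB.aemeasurable.ennreal_ofReal
    hH.aemeasurable.ennreal_ofReal (p := 1 / 3) (q := 2 / 3) (by norm_num) (by norm_num)
    (by norm_num)
  rw [← ofReal_integral_eq_lintegral_ofReal hB (ae_of_all _ hB0),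
    ← ofReal_integral_eq_lintegral_ofReal hH (ae_of_all _ hH0)] at key
  have hle : ENNReal.ofReal (∫ x, A x ∂μ) ≤
      ∫⁻ x, ENNReal.ofReal (B x) ^ (1 / 3 : ℝ) * ENNReal.ofReal (H x) ^ (2 / 3 : ℝ) ∂μ := by
    rw [ofReal_integral_eq_lintegral_ofReal hA (ae_of_all _ hA0)]
    refine lintegral_mono fun x => ?_
    rw [← ENNReal.rpow_le_rpow_iff (z := 3) (by norm_num),
      ENNReal.mul_rpow_of_nonneg _ _ (by norm_num), ← ENNReal.rpow_mul, ← ENNReal.rpow_mul]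
    norm_num
    rw [← ENNReal.ofReal_pow (hA0 x), ← ENNReal.ofReal_pow (hH0 x), ← ENNReal.ofReal_mul (hB0 x)]
    exact ENNReal.ofReal_le_ofReal (h x)
  have h3 := ENNReal.rpow_le_rpow (hle.trans key) (z := 3) (by norm_num)
  rw [ENNReal.mul_rpow_of_nonneg _ _ (by norm_num), ← ENNReal.rpow_mul, ← ENNReal.rpow_mul] at h3
  norm_num at h3
  rw [← ENNReal.ofReal_pow (integral_nonneg hA0), ← ENNReal.ofReal_pow (integral_nonneg hH0),
    ← ENNReal.ofReal_mul (integral_nonneg hB0)] at h3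
  exact (ENNReal.ofReal_le_ofReal_iff
    (mul_nonneg (integral_nonneg hB0) (sq_nonneg _))).1 h3

theorem hasDerivAt_slice_fst {ψ : ℝ × ℝ × ℝ → ℂ} (hψ : Differentiable ℝ ψ) (x : ℝ × ℝ × ℝ) :
    HasDerivAt (fun t => ψ (t, x.2.1, x.2.2)) (fderiv ℝ ψ x (1, 0, 0)) x.1 :=
  (hψ x).hasFDerivAt.comp_hasDerivAt (f := fun t => ((t, x.2.1, x.2.2) : ℝ × ℝ × ℝ)) x.1
    ((hasDerivAt_id _).prodMk ((hasDerivAt_const _ _).prodMk (hasDerivAt_const _ _)))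

theorem pd1_eq_fderiv {ψ : ℝ × ℝ × ℝ → ℂ} (hψ : Differentiable ℝ ψ) :
    pd1 ψ = fun x => fderiv ℝ ψ x (1, 0, 0) :=
  funext fun x => (hasDerivAt_slice_fst hψ x).deriv

theorem pd2_eq_fderiv {ψ : ℝ × ℝ × ℝ → ℂ} (hψ : Differentiable ℝ ψ) :
    pd2 ψ = fun x => fderiv ℝ ψ x (0, 1, 0) :=
  funext fun x => ((hψ x).hasFDerivAt.comp_hasDerivAt
    (f := fun t => ((x.1, t, x.2.2) : ℝ × ℝ × ℝ)) x.2.1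
    ((hasDerivAt_const _ _).prodMk ((hasDerivAt_id _).prodMk (hasDerivAt_const _ _)))).deriv

theorem pd3_eq_fderiv {ψ : ℝ × ℝ × ℝ → ℂ} (hψ : Differentiable ℝ ψ) :
    pd3 ψ = fun x => fderiv ℝ ψ x (0, 0, 1) :=
  funext fun x => ((hψ x).hasFDerivAt.comp_hasDerivAt
    (f := fun t => ((x.1, x.2.1, t) : ℝ × ℝ × ℝ)) x.2.2
    ((hasDerivAt_const _ _).prodMk ((hasDerivAt_const _ _).prodMk (hasDerivAt_id _)))).deriv

theorem continuous_fderiv_apply_const {ψ : ℝ × ℝ × ℝ → ℂ} (hψ : ContDiff ℝ 1 ψ)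
    (v : ℝ × ℝ × ℝ) : Continuous fun x => fderiv ℝ ψ x v :=
  (hψ.continuous_fderiv one_ne_zero).clm_apply continuous_const

theorem contDiff_slice {n : WithTop ℕ∞} {ψ : ℝ × ℝ × ℝ → ℂ} (hψ : ContDiff ℝ n ψ) (p : ℝ × ℝ) :
    ContDiff ℝ n fun t => ψ (t, p) :=
  hψ.comp (contDiff_id.prodMk contDiff_const)

theorem hasCompactSupport_slice {ψ : ℝ × ℝ × ℝ → ℂ} (hc : HasCompactSupport ψ) (p : ℝ × ℝ) :
    HasCompactSupport fun t => ψ (t, p) :=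
  HasCompactSupport.intro (hc.isCompact.image continuous_fst) fun _ ht =>
    image_eq_zero_of_notMem_tsupport fun h => ht ⟨_, h, rfl⟩

theorem integrable_sq_integral_norm {ψ : ℝ × ℝ × ℝ → ℂ} (hψ : Continuous ψ)
    (hc : HasCompactSupport ψ) : Integrable fun p : ℝ × ℝ => (∫ t : ℝ, ‖ψ (t, p)‖) ^ 2 := by
  have hK := hc.isCompact.image (f := Prod.fst) continuous_fst
  have heq : (fun p : ℝ × ℝ => ∫ t : ℝ, ‖ψ (t, p)‖) =
      fun p => ∫ t in Prod.fst '' tsupport ψ, ‖ψ (t, p)‖ := funext fun p =>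
    (setIntegral_eq_integral_of_forall_compl_eq_zero fun t ht => by
      rw [image_eq_zero_of_notMem_tsupport fun h => ht ⟨_, h, rfl⟩, norm_zero]).symm
  have hcont : Continuous (fun p : ℝ × ℝ => ∫ t : ℝ, ‖ψ (t, p)‖) := by
    rw [heq]
    exact continuous_parametric_integral_of_continuous (f := fun p t => ‖ψ (t, p)‖)
      (hψ.norm.comp continuous_swap) hK
  refine (hcont.pow 2).integrable_of_hasCompactSupport
    (HasCompactSupport.intro (hc.isCompact.image (f := Prod.snd) continuous_snd) fun p hp => ?_)
  have h0 : ∀ t, ψ (t, p) = 0 := fun t =>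
    image_eq_zero_of_notMem_tsupport fun h => hp ⟨_, h, rfl⟩
  simp [h0]

/-- Nash's inequality in the longitudinal direction, with a slab removed. -/
theorem nash_compl_slab {ψ : ℝ × ℝ × ℝ → ℂ} (hψ : ContDiff ℝ 1 ψ) (hc : HasCompactSupport ψ)
    (a b : ℝ) :
    (∫ x in (Ioc a b)ᶜ ×ˢ univ, ‖ψ x‖ ^ 2) ^ 3 ≤
      (4 * ∫ x in (Ioc a b)ᶜ ×ˢ univ, ‖pd1 ψ x‖ ^ 2) *
        (∫ p : ℝ × ℝ, (∫ t : ℝ, ‖ψ (t, p)‖) ^ 2) ^ 2 := by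
  have hd := hψ.differentiable one_ne_zero
  have hμ : (volume : Measure (ℝ × ℝ × ℝ)).restrict ((Ioc a b)ᶜ ×ˢ univ) =
      (volume.restrict (Ioc a b)ᶜ).prod volume := by
    rw [Measure.volume_eq_prod, ← Measure.prod_restrict, Measure.restrict_univ]
  have hp1 : Continuous (pd1 ψ) := by
    rw [pd1_eq_fderiv hd]; exact continuous_fderiv_apply_const hψ _
  have hp1c : HasCompactSupport (pd1 ψ) := by
    rw [pd1_eq_fderiv hd]; exact hc.fderiv_apply (𝕜 := ℝ) _
  have hi := (integrable_norm_sq (μ := volume) hψ.continuous hc).restrict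
    (s := (Ioc a b)ᶜ ×ˢ univ)
  have hi1 := (integrable_norm_sq (μ := volume) hp1 hp1c).restrict (s := (Ioc a b)ᶜ ×ˢ univ)
  rw [hμ] at hi hi1 ⊢
  rw [integral_prod_symm _ hi, integral_prod_symm _ hi1, ← integral_const_mul]
  refine integral_cube_le_of_cube_le (fun p => integral_nonneg fun t => by positivity)
    (fun p => mul_nonneg (by norm_num) (integral_nonneg fun t => by positivity))
    (fun p => by positivity) hi.integral_prod_right (hi1.integral_prod_right.const_mul 4)
    (integrable_sq_integral_norm hψ.continuous hc) fun p => ?_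
  exact nash_compl_Ioc (contDiff_slice hψ p) (hasCompactSupport_slice hc p)

theorem integral_mul_inner_fderiv {ψ : ℝ × ℝ × ℝ → ℂ} (hψ : ContDiff ℝ 1 ψ)
    (hc : HasCompactSupport ψ) {c c' : ℝ × ℝ × ℝ → ℝ} (hcc : Continuous c) (hcc' : Continuous c')
    {v : ℝ × ℝ × ℝ} (h : ∀ x, HasLineDerivAt ℝ c (c' x) x v) :
    ∫ x, c x * (2 * inner ℝ (ψ x) (fderiv ℝ ψ x v)) = -∫ x, c' x * ‖ψ x‖ ^ 2 := by
  have hcs := hasCompactSupport_norm_sq hc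
  have hcont : Continuous fun x => ‖ψ x‖ ^ 2 := hψ.continuous.norm.pow 2
  have : (volume : Measure (ℝ × ℝ)).IsAddHaarMeasure :=
    Measure.prod.instIsAddHaarMeasure volume volume
  have : (volume : Measure (ℝ × ℝ × ℝ)).IsAddHaarMeasure :=
    Measure.prod.instIsAddHaarMeasure volume volume
  refine integral_bilinear_hasLineDerivAt_right_eq_neg_left_of_integrable
    (B := ContinuousLinearMap.mul ℝ ℝ) (μ := volume) (v := v) ?_ ?_ ?_ (fun x _ => h x) fun x _ => ?_
  · exact (hcc'.mul hcont).integrable_of_hasCompactSupport hcs.mul_left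
  · refine (hcc.mul (continuous_const.mul (hψ.continuous.inner
      (continuous_fderiv_apply_const hψ v)))).integrable_of_hasCompactSupport
      (hc.mono fun x hx h0 => hx ?_)
    simp [h0]
  · exact (hcc.mul hcont).integrable_of_hasCompactSupport hcs.mul_left
  · have := ((hψ.differentiable one_ne_zero) x).hasFDerivAt.norm_sq.hasLineDerivAt v
    simpa [mul_add] using this

theorem integrable_mul_inner_fderiv {ψ : ℝ × ℝ × ℝ → ℂ} (hψ : ContDiff ℝ 1 ψ)
    (hc : HasCompactSupport ψ) {c : ℝ × ℝ × ℝ → ℝ} (hcc : Continuous c) (v : ℝ × ℝ × ℝ) :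
    Integrable fun x => c x * (2 * inner ℝ (ψ x) (fderiv ℝ ψ x v)) := by
  refine (hcc.mul (continuous_const.mul (hψ.continuous.inner
    (continuous_fderiv_apply_const hψ v)))).integrable_of_hasCompactSupport
    (hc.mono fun x hx h0 => hx ?_)
  simp [h0]

/-- A virial identity for the twisted longitudinal derivative `∂₁ - g ∂_τ`, which is the
derivative along a divergence-free field. -/
theorem integral_virial {ψ : ℝ × ℝ × ℝ → ℂ} (hψ : ContDiff ℝ 1 ψ) (hc : HasCompactSupport ψ)
    {g : ℝ → ℝ} (hg : Continuous g) :
    ∫ x : ℝ × ℝ × ℝ, (1 + x.1 ^ 2)⁻¹ * ‖ψ x‖ ^ 2 =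
      -∫ x : ℝ × ℝ × ℝ, arctan x.1 * (2 * inner ℝ (ψ x) (pd1 ψ x - g x.1 • pdtau ψ x)) := by
  have hd := hψ.differentiable one_ne_zero
  have hcat : Continuous fun x : ℝ × ℝ × ℝ => arctan x.1 := continuous_arctan.comp continuous_fst
  have hc2 : Continuous fun x : ℝ × ℝ × ℝ => arctan x.1 * g x.1 * x.2.2 := by fun_prop
  have hc3 : Continuous fun x : ℝ × ℝ × ℝ => arctan x.1 * g x.1 * x.2.1 := by fun_prop
  have h1 := integral_mul_inner_fderiv hψ hc hcat (c' := fun x => (1 + x.1 ^ 2)⁻¹)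
    ((by fun_prop : Continuous fun x : ℝ × ℝ × ℝ => 1 + x.1 ^ 2).inv₀ fun x => by positivity)
    (v := (1, 0, 0)) (fun x => by
      have h := (Real.hasDerivAt_arctan (x.1 + 0)).comp_const_add x.1 0
      simpa [HasLineDerivAt, one_div] using h)
  have h2 := integral_mul_inner_fderiv hψ hc hc2 (c' := fun x => 0) continuous_const
    (v := (0, 1, 0)) (fun x => by simpa [HasLineDerivAt] using hasDerivAt_const _ _)
  have h3 := integral_mul_inner_fderiv hψ hc hc3 (c' := fun x => 0) continuous_const
    (v := (0, 0, 1)) (fun x => by simpa [HasLineDerivAt] using hasDerivAt_const _ _)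
  simp only [zero_mul, integral_zero, neg_zero] at h2 h3
  have hsplit : ∀ x : ℝ × ℝ × ℝ,
      arctan x.1 * (2 * inner ℝ (ψ x) (pd1 ψ x - g x.1 • pdtau ψ x)) =
      arctan x.1 * (2 * inner ℝ (ψ x) (fderiv ℝ ψ x (1, 0, 0))) -
      arctan x.1 * g x.1 * x.2.2 * (2 * inner ℝ (ψ x) (fderiv ℝ ψ x (0, 1, 0))) +
      arctan x.1 * g x.1 * x.2.1 * (2 * inner ℝ (ψ x) (fderiv ℝ ψ x (0, 0, 1))) := fun x => by
    rw [pdtau, pd1_eq_fderiv hd, pd2_eq_fderiv hd, pd3_eq_fderiv hd]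
    simp only [inner_sub_right, inner_smul_right]
    ring
  have i1 := integrable_mul_inner_fderiv hψ hc hcat (1, 0, 0)
  have i2 := integrable_mul_inner_fderiv hψ hc hc2 (0, 1, 0)
  have i3 := integrable_mul_inner_fderiv hψ hc hc3 (0, 0, 1)
  have i12 : Integrable fun x : ℝ × ℝ × ℝ =>
      arctan x.1 * (2 * inner ℝ (ψ x) (fderiv ℝ ψ x (1, 0, 0))) -
      arctan x.1 * g x.1 * x.2.2 * (2 * inner ℝ (ψ x) (fderiv ℝ ψ x (0, 1, 0))) := i1.sub i2
  simp_rw [hsplit]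
  rw [integral_add i12 i3, integral_sub i1 i2, h1, h2, h3]
  simp

theorem E1_nonneg (ω : Set (ℝ × ℝ)) : 0 ≤ E1 ω := by
  refine Real.sInf_nonneg ?_
  rintro r ⟨f, -, -, rfl⟩
  exact div_nonneg (integral_nonneg fun p => by positivity)
    (integral_nonneg fun p => by positivity)

theorem E1_mul_integral_le {ω : Set (ℝ × ℝ)} {f : ℝ × ℝ → ℂ} (hf : IsTest2 ω f) :
    E1 ω * ∫ p in ω, ‖f p‖ ^ 2 ≤ ∫ p in ω, (‖pd1' f p‖ ^ 2 + ‖pd2' f p‖ ^ 2) := by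
  have h0 : 0 ≤ ∫ p in ω, (‖pd1' f p‖ ^ 2 + ‖pd2' f p‖ ^ 2) :=
    integral_nonneg fun p => by positivity
  have hn : 0 ≤ ∫ p in ω, ‖f p‖ ^ 2 := integral_nonneg fun p => by positivity
  rcases hn.eq_or_lt with h | h
  · rwa [← h, mul_zero]
  · rw [← le_div_iff₀ h]
    refine csInf_le ⟨0, ?_⟩ ⟨f, hf, ?_, rfl⟩
    · rintro r ⟨g, -, -, rfl⟩
      exact div_nonneg (integral_nonneg fun p => by positivity)
        (integral_nonneg fun p => by positivity)
    · rintro rfl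
      simp at h

theorem fderiv_apply_eq_zero_of_notMem_tsupport {ψ : ℝ × ℝ × ℝ → ℂ} {x : ℝ × ℝ × ℝ}
    (hx : x ∉ tsupport ψ) (v : ℝ × ℝ × ℝ) : fderiv ℝ ψ x v = 0 :=
  image_eq_zero_of_notMem_tsupport (f := fun x => fderiv ℝ ψ x v) fun h =>
    hx (tsupport_fderiv_apply_subset ℝ v h)

theorem IsTest3.isTest2_slice {ω : Set (ℝ × ℝ)} {ψ : ℝ × ℝ × ℝ → ℂ}
    (hψ : IsTest3 (Omega0 ω) ψ) (s : ℝ) : IsTest2 ω fun p => ψ (s, p) := by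
  obtain ⟨h1, h2, h3⟩ := hψ
  have hsub : tsupport (fun p => ψ (s, p)) ⊆ (fun p => (s, p)) ⁻¹' tsupport ψ :=
    closure_minimal (fun p hp => subset_tsupport ψ hp)
      ((isClosed_tsupport ψ).preimage (by fun_prop))
  refine ⟨h1.comp (contDiff_const.prodMk contDiff_id),
    HasCompactSupport.intro (h2.isCompact.image continuous_snd) fun p hp => ?_,
    fun p hp => h3 (hsub hp)⟩
  exact image_eq_zero_of_notMem_tsupport (f := ψ) fun h => hp ⟨_, h, rfl⟩

theorem continuous_pd {ψ : ℝ × ℝ × ℝ → ℂ} (hψ : ContDiff ℝ 1 ψ) :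
    Continuous (pd1 ψ) ∧ Continuous (pd2 ψ) ∧ Continuous (pd3 ψ) := by
  have hd := hψ.differentiable one_ne_zero
  rw [pd1_eq_fderiv hd, pd2_eq_fderiv hd, pd3_eq_fderiv hd]
  exact ⟨continuous_fderiv_apply_const hψ _, continuous_fderiv_apply_const hψ _,
    continuous_fderiv_apply_const hψ _⟩

theorem pd_eq_zero_of_notMem_tsupport {ψ : ℝ × ℝ × ℝ → ℂ} (hψ : Differentiable ℝ ψ)
    {x : ℝ × ℝ × ℝ} (hx : x ∉ tsupport ψ) : pd1 ψ x = 0 ∧ pd2 ψ x = 0 ∧ pd3 ψ x = 0 := by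
  rw [pd1_eq_fderiv hψ, pd2_eq_fderiv hψ, pd3_eq_fderiv hψ]
  exact ⟨fderiv_apply_eq_zero_of_notMem_tsupport hx _,
    fderiv_apply_eq_zero_of_notMem_tsupport hx _, fderiv_apply_eq_zero_of_notMem_tsupport hx _⟩

theorem integrable_norm_sq_pd {ψ : ℝ × ℝ × ℝ → ℂ} (hψ : ContDiff ℝ 1 ψ)
    (hc : HasCompactSupport ψ) : Integrable (fun x => ‖pd1 ψ x‖ ^ 2) ∧
      Integrable (fun x => ‖pd2 ψ x‖ ^ 2 + ‖pd3 ψ x‖ ^ 2) := by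
  have hz := fun x hx => pd_eq_zero_of_notMem_tsupport (hψ.differentiable one_ne_zero) (x := x) hx
  obtain ⟨h1, h2, h3⟩ := continuous_pd hψ
  exact ⟨integrable_norm_sq h1 (HasCompactSupport.intro hc fun x hx => (hz x hx).1),
    (integrable_norm_sq h2 (HasCompactSupport.intro hc fun x hx => (hz x hx).2.1)).add
      (integrable_norm_sq h3 (HasCompactSupport.intro hc fun x hx => (hz x hx).2.2))⟩

theorem integrable_norm_sq_twisted {ψ : ℝ × ℝ × ℝ → ℂ} (hψ : ContDiff ℝ 1 ψ)
    (hc : HasCompactSupport ψ) {g : ℝ → ℝ} (hg : Continuous g) :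
    Integrable fun x => ‖pd1 ψ x - g x.1 • pdtau ψ x‖ ^ 2 := by
  obtain ⟨h1, h2, h3⟩ := continuous_pd hψ
  refine integrable_norm_sq (f := fun x => pd1 ψ x - g x.1 • pdtau ψ x)
    (by unfold pdtau; fun_prop) (HasCompactSupport.intro hc fun x hx => ?_)
  obtain ⟨z1, z2, z3⟩ := pd_eq_zero_of_notMem_tsupport (hψ.differentiable one_ne_zero) hx
  simp [pdtau, z1, z2, z3]

theorem E1_mul_integral_tube_le {ω : Set (ℝ × ℝ)} {ψ : ℝ × ℝ × ℝ → ℂ}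
    (hψ : IsTest3 (Omega0 ω) ψ) :
    E1 ω * ∫ x, ‖ψ x‖ ^ 2 ≤ ∫ x, (‖pd2 ψ x‖ ^ 2 + ‖pd3 ψ x‖ ^ 2) := by
  have hψ1 : ContDiff ℝ 1 ψ := hψ.1.of_le (by exact_mod_cast le_top)
  have hi := integrable_norm_sq (μ := volume) hψ.1.continuous hψ.2.1
  have hi' := (integrable_norm_sq_pd hψ1 hψ.2.1).2
  rw [Measure.volume_eq_prod] at hi hi' ⊢
  rw [integral_prod _ hi, integral_prod _ hi', ← integral_const_mul]
  refine integral_mono (hi.integral_prod_left.const_mul _) hi'.integral_prod_left fun s => ?_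
  have h := E1_mul_integral_le (hψ.isTest2_slice s)
  rw [setIntegral_eq_integral_of_forall_compl_eq_zero,
    setIntegral_eq_integral_of_forall_compl_eq_zero] at h
  · exact h
  · intro p hp
    obtain ⟨-, z2, z3⟩ := pd_eq_zero_of_notMem_tsupport (hψ1.differentiable one_ne_zero)
      (x := (s, p)) fun h => hp (hψ.2.2 h)
    change ‖pd2 ψ (s, p)‖ ^ 2 + ‖pd3 ψ (s, p)‖ ^ 2 = 0
    simp [z2, z3]
  · intro p hp
    rw [image_eq_zero_of_notMem_tsupport (f := ψ) fun h => hp (hψ.2.2 h)]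
    simp

/-- The mass in a slab is controlled by the total mass and the twisted longitudinal energy. -/
theorem integral_slab_le {ψ : ℝ × ℝ × ℝ → ℂ} (hψ : ContDiff ℝ 1 ψ) (hc : HasCompactSupport ψ)
    {g : ℝ → ℝ} (hg : Continuous g) (L : ℝ) :
    ∫ x in Ioc (-L) L ×ˢ univ, ‖ψ x‖ ^ 2 ≤ (∫ x, ‖ψ x‖ ^ 2) / 4 +
      16 * (1 + L ^ 2) ^ 2 * ∫ x, ‖pd1 ψ x - g x.1 • pdtau ψ x‖ ^ 2 := by
  have hi := integrable_norm_sq (μ := volume) hψ.continuous hc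
  have hX := integrable_norm_sq_twisted hψ hc hg
  have hw : Integrable fun x : ℝ × ℝ × ℝ => (1 + L ^ 2) * ((1 + x.1 ^ 2)⁻¹ * ‖ψ x‖ ^ 2) := by
    refine Integrable.const_mul (hi.mono'
      (AEStronglyMeasurable.mul (by fun_prop) hi.aestronglyMeasurable)
      (ae_of_all _ fun x => ?_)) _
    change ‖(1 + x.1 ^ 2)⁻¹ * ‖ψ x‖ ^ 2‖ ≤ _
    rw [Real.norm_of_nonneg (show 0 ≤ (1 + x.1 ^ 2)⁻¹ * ‖ψ x‖ ^ 2 by positivity)]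
    exact mul_le_of_le_one_left (by positivity)
      (inv_le_one_of_one_le₀ (by nlinarith [sq_nonneg x.1]))
  have hsum : Integrable fun x => ‖ψ x‖ ^ 2 / 4 +
      16 * (1 + L ^ 2) ^ 2 * ‖pd1 ψ x - g x.1 • pdtau ψ x‖ ^ 2 :=
    (hi.div_const 4).add (hX.const_mul _)
  calc ∫ x in Ioc (-L) L ×ˢ univ, ‖ψ x‖ ^ 2
      ≤ ∫ x : ℝ × ℝ × ℝ in Ioc (-L) L ×ˢ univ, (1 + L ^ 2) * ((1 + x.1 ^ 2)⁻¹ * ‖ψ x‖ ^ 2) := by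
        refine setIntegral_mono_on hi.integrableOn hw.integrableOn
          (measurableSet_Ioc.prod MeasurableSet.univ) fun x hx => ?_
        obtain ⟨⟨h1, h2⟩, -⟩ := hx
        rw [← mul_assoc, ← div_eq_mul_inv]
        refine le_mul_of_one_le_left (by positivity) ?_
        rw [one_le_div (by positivity)]
        nlinarith
    _ ≤ ∫ x : ℝ × ℝ × ℝ, (1 + L ^ 2) * ((1 + x.1 ^ 2)⁻¹ * ‖ψ x‖ ^ 2) :=
        setIntegral_le_integral hw (ae_of_all _ fun x => by positivity)
    _ = ∫ x : ℝ × ℝ × ℝ, -(1 + L ^ 2) *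
          (arctan x.1 * (2 * inner ℝ (ψ x) (pd1 ψ x - g x.1 • pdtau ψ x))) := by
        rw [integral_const_mul, integral_const_mul, integral_virial hψ hc hg]
        ring
    _ ≤ ∫ x, (‖ψ x‖ ^ 2 / 4 +
          16 * (1 + L ^ 2) ^ 2 * ‖pd1 ψ x - g x.1 • pdtau ψ x‖ ^ 2) := by
        refine (Real.le_norm_self _).trans (norm_integral_le_of_norm_le hsum
          (ae_of_all _ fun x => ?_))
        have hat : |arctan x.1| ≤ 2 := abs_le.2
          ⟨by linarith [neg_pi_div_two_lt_arctan x.1, pi_lt_four],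
            by linarith [arctan_lt_pi_div_two x.1, pi_lt_four]⟩
        have hin := norm_inner_le_norm (𝕜 := ℝ) (ψ x) (pd1 ψ x - g x.1 • pdtau ψ x)
        simp only [norm_mul, norm_neg, Real.norm_two,
          Real.norm_of_nonneg (show 0 ≤ 1 + L ^ 2 by positivity)]
        calc (1 + L ^ 2) * (‖arctan x.1‖ * (2 * ‖inner ℝ (ψ x) (pd1 ψ x - g x.1 • pdtau ψ x)‖))
            ≤ (1 + L ^ 2) * (2 * (2 * (‖ψ x‖ * ‖pd1 ψ x - g x.1 • pdtau ψ x‖))) := by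
              gcongr
              exact hat
          _ ≤ _ := by
              nlinarith [sq_nonneg (‖ψ x‖ / 2 -
                4 * (1 + L ^ 2) * ‖pd1 ψ x - g x.1 • pdtau ψ x‖)]
    _ = _ := by
        rw [integral_add (hi.div_const 4) (hX.const_mul _), integral_div, integral_const_mul]

theorem cube_le_of_slab_estimates {E M P T Mi Mo B H k c : ℝ} (hE : 0 ≤ E) (hM : 0 ≤ M)
    (hP : 0 ≤ P) (hk : 0 < k) (hc : 0 ≤ c) (hsum : M = Mi + Mo) (hET : E * M ≤ T)
    (hin : Mi ≤ M / 4 + k * P) (hout : Mo ^ 3 ≤ 4 * P * H ^ 2) (htot : M ^ 3 ≤ 4 * B * H ^ 2)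
    (hB : B ≤ c * (P + T)) :
    M ^ 3 ≤ (32 + 4 * c * (1 + 4 * k * E)) * (P + T - E * M) * H ^ 2 := by
  have hPD : P ≤ P + T - E * M := by linarith
  have hTD : P + T = (P + T - E * M) + E * M := by ring
  generalize P + T - E * M = D at *
  have hD : 0 ≤ D := hP.trans hPD
  rcases le_or_gt M (4 * k * D) with h | h
  · calc M ^ 3 ≤ 4 * (c * (D + E * (4 * k * D))) * H ^ 2 := by
          refine htot.trans ?_
          gcongr
          refine hB.trans ?_
          rw [hTD]
          gcongr
      _ = (4 * c * (1 + 4 * k * E)) * D * H ^ 2 := by ring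
      _ ≤ _ := by
          gcongr
          linarith
  · have hkP : k * P ≤ k * D := by gcongr
    have hM2 : M ≤ 2 * Mo := by linarith
    calc M ^ 3 ≤ (2 * Mo) ^ 3 := by gcongr
      _ = 8 * Mo ^ 3 := by ring
      _ ≤ 8 * (4 * P * H ^ 2) := by gcongr
      _ ≤ 8 * (4 * D * H ^ 2) := by gcongr
      _ = 32 * D * H ^ 2 := by ring
      _ ≤ _ := by
          gcongr
          exact le_add_of_nonneg_right (by positivity)

theorem norm_pd1_sq_le {ψ : ℝ × ℝ × ℝ → ℂ} {x : ℝ × ℝ × ℝ} {γ m R : ℝ} (hγ : |γ| ≤ m)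
    (h2 : |x.2.1| ≤ R) (h3 : |x.2.2| ≤ R) :
    ‖pd1 ψ x‖ ^ 2 ≤ (2 + 4 * m ^ 2 * R ^ 2) *
      (‖pd1 ψ x - γ • pdtau ψ x‖ ^ 2 + (‖pd2 ψ x‖ ^ 2 + ‖pd3 ψ x‖ ^ 2)) := by
  have hm : 0 ≤ m := (abs_nonneg γ).trans hγ
  have hR : 0 ≤ R := (abs_nonneg _).trans h2
  have htau : ‖γ • pdtau ψ x‖ ≤ m * (R * ‖pd2 ψ x‖ + R * ‖pd3 ψ x‖) := by
    rw [norm_smul, Real.norm_eq_abs]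
    gcongr
    refine (norm_sub_le _ _).trans ?_
    rw [norm_smul, norm_smul, Real.norm_eq_abs, Real.norm_eq_abs]
    gcongr
  have h1 : ‖pd1 ψ x‖ ≤ ‖pd1 ψ x - γ • pdtau ψ x‖ + m * (R * ‖pd2 ψ x‖ + R * ‖pd3 ψ x‖) :=
    calc ‖pd1 ψ x‖ = ‖(pd1 ψ x - γ • pdtau ψ x) + γ • pdtau ψ x‖ := by rw [sub_add_cancel]
      _ ≤ _ := (norm_add_le _ _).trans (by gcongr)
  generalize ‖pd1 ψ x - γ • pdtau ψ x‖ = X at *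
  generalize ‖pd2 ψ x‖ = u at *
  generalize ‖pd3 ψ x‖ = v at *
  calc ‖pd1 ψ x‖ ^ 2 ≤ (X + m * (R * u + R * v)) ^ 2 := by gcongr
    _ ≤ 2 * X ^ 2 + 4 * m ^ 2 * R ^ 2 * (u ^ 2 + v ^ 2) := by
      nlinarith [sq_nonneg (X - m * (R * u + R * v)), sq_nonneg (m * R * (u - v))]
    _ ≤ _ := by
      nlinarith [mul_nonneg (sq_nonneg (m * R)) (sq_nonneg X), sq_nonneg u, sq_nonneg v]

theorem mixedNorm1Sq_eq_integral {ω : Set (ℝ × ℝ)} {ψ : ℝ × ℝ × ℝ → ℂ}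
    (hψ : IsTest3 (Omega0 ω) ψ) :
    mixedNorm1Sq ω ψ = ∫ p : ℝ × ℝ, (∫ t : ℝ, ‖ψ (t, p)‖) ^ 2 := by
  refine setIntegral_eq_integral_of_forall_compl_eq_zero fun p hp => ?_
  have h0 : ∀ t, ψ (t, p) = 0 := fun t =>
    image_eq_zero_of_notMem_tsupport fun h => hp (hψ.2.2 h)
  simp [h0]

theorem Qform_eq_integral_add {ω : Set (ℝ × ℝ)} {ψ : ℝ × ℝ × ℝ → ℂ}
    (hψ : IsTest3 (Omega0 ω) ψ) {θ : ℝ → ℝ} (hθ : Continuous (deriv θ)) :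
    Qform θ ω ψ = (∫ x, ‖pd1 ψ x - deriv θ x.1 • pdtau ψ x‖ ^ 2) +
      ∫ x, (‖pd2 ψ x‖ ^ 2 + ‖pd3 ψ x‖ ^ 2) := by
  have hψ1 : ContDiff ℝ 1 ψ := hψ.1.of_le (by exact_mod_cast le_top)
  rw [← integral_add (integrable_norm_sq_twisted hψ1 hψ.2.1 hθ)
    (integrable_norm_sq_pd hψ1 hψ.2.1).2, Qform,
    setIntegral_eq_integral_of_forall_compl_eq_zero]
  · simp only [add_assoc]
  · intro x hx
    obtain ⟨z1, z2, z3⟩ := pd_eq_zero_of_notMem_tsupport (hψ1.differentiable one_ne_zero)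
      fun h => hx (hψ.2.2 h)
    simp [pdtau, z1, z2, z3]

/-- the Sobolev-type inequality in tubes. If θ̇ has compact support,
there is c_S > 0 (depending on θ̇ and ω) such that for every nonzero ψ ∈ C_c^∞(Ω₀),
Q_θ[ψ] − E₁∫|ψ|² ≥ c_S (∫|ψ|²)³ / ‖ψ‖₁⁴. -/
theorem sobolev_inequality_tube
    (ω : Set (ℝ × ℝ)) (hω_open : IsOpen ω) (hω_bdd : Bornology.IsBounded ω)
    (hω_conn : IsConnected ω)
    (θ : ℝ → ℝ) (hθ : ContDiff ℝ 1 θ) (hθ' : ∃ M : ℝ, ∀ t : ℝ, |deriv θ t| ≤ M)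
    (hsupp : HasCompactSupport (deriv θ)) :
    ∃ cS : ℝ, 0 < cS ∧ ∀ ψ : ℝ × ℝ × ℝ → ℂ, IsTest3 (Omega0 ω) ψ → ψ ≠ 0 →
      cS * (∫ x in Omega0 ω, ‖ψ x‖ ^ 2) ^ 3 / (mixedNorm1Sq ω ψ) ^ 2
        ≤ Qform θ ω ψ - E1 ω * ∫ x in Omega0 ω, ‖ψ x‖ ^ 2 := by
  obtain ⟨m, hm⟩ := hθ'
  obtain ⟨R, hR⟩ := hω_bdd.exists_norm_le
  have hg : Continuous (deriv θ) := hθ.continuous_deriv_one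
  obtain ⟨L, hL⟩ := hsupp.isCompact.isBounded.exists_norm_le
  have hout : ∀ t ∉ Ioc (-(L + 1)) (L + 1), deriv θ t = 0 := fun t ht =>
    image_eq_zero_of_notMem_tsupport fun h => ht
      ⟨by linarith [(abs_le.1 (hL t h)).1], by linarith [(abs_le.1 (hL t h)).2]⟩
  have hE := E1_nonneg ω
  set k : ℝ := 16 * (1 + (L + 1) ^ 2) ^ 2 with hk
  set c : ℝ := 2 + 4 * m ^ 2 * R ^ 2 with hc
  set C : ℝ := 32 + 4 * c * (1 + 4 * k * E1 ω) with hC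
  have hC0 : 0 < C := by positivity
  refine ⟨C⁻¹, by positivity, fun ψ hψ _ => ?_⟩
  have hψ1 : ContDiff ℝ 1 ψ := hψ.1.of_le (by exact_mod_cast le_top)
  have hi := integrable_norm_sq (μ := volume) hψ.1.continuous hψ.2.1
  obtain ⟨i1, iT⟩ := integrable_norm_sq_pd hψ1 hψ.2.1
  have iX := integrable_norm_sq_twisted hψ1 hψ.2.1 hg
  have hE1 := E1_mul_integral_tube_le hψ
  have hP : 0 ≤ ∫ x, ‖pd1 ψ x - deriv θ x.1 • pdtau ψ x‖ ^ 2 :=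
    integral_nonneg fun x => by positivity
  have hmeas : MeasurableSet (Ioc (-(L + 1)) (L + 1) ×ˢ (univ : Set (ℝ × ℝ))) :=
    measurableSet_Ioc.prod MeasurableSet.univ
  have hcompl : (Ioc (-(L + 1)) (L + 1) ×ˢ (univ : Set (ℝ × ℝ)))ᶜ =
      (Ioc (-(L + 1)) (L + 1))ᶜ ×ˢ univ := by
    ext x
    simp
  have hB : ∫ x, ‖pd1 ψ x‖ ^ 2 ≤ c * ((∫ x, ‖pd1 ψ x - deriv θ x.1 • pdtau ψ x‖ ^ 2) +
      ∫ x, (‖pd2 ψ x‖ ^ 2 + ‖pd3 ψ x‖ ^ 2)) := by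
    rw [← integral_add iX iT, ← integral_const_mul]
    refine integral_mono i1 ((iX.add iT).const_mul c) fun x => ?_
    by_cases hx : x ∈ tsupport ψ
    · have hxR := hR x.2 (hψ.2.2 hx)
      exact norm_pd1_sq_le (hm x.1) ((norm_fst_le x.2).trans hxR) ((norm_snd_le x.2).trans hxR)
    · simp only [(pd_eq_zero_of_notMem_tsupport (hψ1.differentiable one_ne_zero) hx).1, norm_zero,
        zero_pow two_ne_zero]
      exact mul_nonneg (by positivity) (by positivity)
  have hslab : 4 * ∫ x in (Ioc (-(L + 1)) (L + 1))ᶜ ×ˢ univ, ‖pd1 ψ x‖ ^ 2 ≤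
      4 * ∫ x, ‖pd1 ψ x - deriv θ x.1 • pdtau ψ x‖ ^ 2 := by
    refine mul_le_mul_of_nonneg_left ?_ (by norm_num)
    refine le_trans (le_of_eq (setIntegral_congr_fun (hcompl ▸ hmeas.compl) fun x hx => ?_))
      (setIntegral_le_integral iX (ae_of_all _ fun x => by positivity))
    simp [hout x.1 hx.1]
  have hnash := nash_compl_slab hψ1 hψ.2.1 0 0
  simp only [Ioc_self, compl_empty, univ_prod_univ, Measure.restrict_univ] at hnash
  have key := cube_le_of_slab_estimates (k := k) (c := c) hE
    (integral_nonneg fun x => by positivity) hP (by positivity) (by positivity)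
    (integral_add_compl hmeas hi).symm hE1
    (integral_slab_le hψ1 hψ.2.1 hg (L + 1))
    (by
      rw [hcompl]
      refine (nash_compl_slab hψ1 hψ.2.1 _ _).trans ?_
      gcongr)
    hnash hB
  have hM : ∫ x in Omega0 ω, ‖ψ x‖ ^ 2 = ∫ x, ‖ψ x‖ ^ 2 :=
    setIntegral_eq_integral_of_forall_compl_eq_zero fun x hx => by
      rw [image_eq_zero_of_notMem_tsupport fun h => hx (hψ.2.2 h)]
      simp
  rw [hM, mixedNorm1Sq_eq_integral hψ, Qform_eq_integral_add hψ hg]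
  refine div_le_of_le_mul₀ (sq_nonneg _) (by linarith) ?_
  rw [inv_mul_le_iff₀ hC0, ← mul_assoc]
  exact key
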